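/- arXiv:1609.05443 — 2 statements merged into one kernel-verified Lean document; each statement's English description precedes it below -/
import Mathlib

section
/- For every 1/2 ≤ ν < 1, there exists a unique real number m > 0 such that ∫₀^m M_ν(u) du = 1/2 (this number m = m_c(ν) is the median parameter of the Green function of the Cauchy problem). -/
open Real MeasureTheory Set

/-- The Mainardi function `M_ν(x) = Σ_{n=0}^∞ (−x)^n/(n! · Γ(1 − ν − νn))`. -/
noncomputable def mainardi (ν x : ℝ) : ℝ :=
  ∑' n : ℕ, (-x) ^ n / ((n.factorial : ℝ) * Real.Gamma (1 - ν - ν * n))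

open Filter Topology PowerSeries

/-- The power series `(1 - X) ^ (-a)`. -/
noncomputable def oneSubRpowNeg (a : ℝ) : PowerSeries ℝ :=
  rescale (-1) (binomialSeries ℝ (-a))

lemma smeval_descPochhammer_neg (a : ℝ) (k : ℕ) :
    (descPochhammer ℤ k).smeval (-a) = (-1) ^ k * ∏ i ∈ Finset.range k, (a + i) := by
  induction k with
  | zero => simp
  | succ k ih =>
    rw [descPochhammer_succ_right, Polynomial.smeval_mul, ih, Polynomial.smeval_sub,
      Polynomial.smeval_X, Polynomial.smeval_natCast, Finset.prod_range_succ]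
    simp
    ring

lemma coeff_oneSubRpowNeg (a : ℝ) (k : ℕ) :
    coeff k (oneSubRpowNeg a) = ∏ i ∈ Finset.range k, (a + i) / (i + 1) := by
  have h : (Nat.factorial k : ℝ) = ∏ i ∈ Finset.range k, ((i : ℝ) + 1) := by
    rw [← Finset.prod_range_add_one_eq_factorial]; push_cast; rfl
  have h1 : ((-1 : ℝ) ^ k) * (-1) ^ k = 1 := by rw [← mul_pow]; norm_num
  rw [oneSubRpowNeg, coeff_rescale, binomialSeries_coeff, Ring.choose_eq_smul,
    smeval_descPochhammer_neg, Finset.prod_div_distrib, ← h, smul_eq_mul, smul_eq_mul, mul_one,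
    div_eq_inv_mul, mul_left_comm, ← mul_assoc ((-1 : ℝ) ^ k), h1, one_mul]

lemma oneSubRpowNeg_add (a b : ℝ) :
    oneSubRpowNeg (a + b) = oneSubRpowNeg a * oneSubRpowNeg b := by
  rw [oneSubRpowNeg, neg_add, binomialSeries_add, map_mul]; rfl

lemma oneSubRpowNeg_zero : oneSubRpowNeg 0 = 1 := by
  simp [oneSubRpowNeg]

lemma oneSubRpowNeg_pow (a : ℝ) (n : ℕ) : oneSubRpowNeg a ^ n = oneSubRpowNeg (n * a) := by
  induction n with
  | zero => simp [oneSubRpowNeg_zero]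
  | succ n ih => rw [pow_succ, ih, ← oneSubRpowNeg_add]; push_cast; ring_nf

lemma coeff_mul_nonneg {f g : PowerSeries ℝ} (hf : ∀ k, 0 ≤ coeff k f) (hg : ∀ k, 0 ≤ coeff k g)
    (k : ℕ) : 0 ≤ coeff k (f * g) := by
  rw [coeff_mul]
  exact Finset.sum_nonneg fun p _ => mul_nonneg (hf _) (hg _)

lemma coeff_pow_nonneg {f : PowerSeries ℝ} (hf : ∀ k, 0 ≤ coeff k f) (n k : ℕ) :
    0 ≤ coeff k (f ^ n) := by
  induction n generalizing k with
  | zero => rw [pow_zero, coeff_one]; split_ifs <;> norm_num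
  | succ n ih => rw [pow_succ]; exact coeff_mul_nonneg ih hf k

lemma coeff_oneSubRpowNeg_nonneg {a : ℝ} (ha : 0 ≤ a) (k : ℕ) :
    0 ≤ coeff k (oneSubRpowNeg a) := by
  rw [coeff_oneSubRpowNeg]
  exact Finset.prod_nonneg fun i _ => by positivity

lemma coeff_one_sub_oneSubRpowNeg_nonneg {ν : ℝ} (h0 : 0 ≤ ν) (h1 : ν ≤ 1) (k : ℕ) :
    0 ≤ coeff k (1 - oneSubRpowNeg (-ν)) := by
  rw [map_sub, coeff_oneSubRpowNeg, coeff_one]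
  cases k with
  | zero => simp
  | succ k =>
    rw [Finset.prod_range_succ', if_neg (Nat.succ_ne_zero k)]
    have : 0 ≤ ∏ i ∈ Finset.range k, (-ν + ((i + 1 : ℕ) : ℝ)) / (((i + 1 : ℕ) : ℝ) + 1) :=
      Finset.prod_nonneg fun i _ => div_nonneg (by push_cast; linarith [Nat.cast_nonneg (α := ℝ) i])
        (by positivity)
    simp only [Nat.cast_zero, add_zero, zero_add, div_one]
    nlinarith

/-- The coefficient of `X ^ k` in `(1 - X) ^ (-β) * (1 - (1 - X) ^ ν) ^ N`. -/
noncomputable def sibuyaCoeff (ν β : ℝ) (N k : ℕ) : ℝ :=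
  coeff k (oneSubRpowNeg β * (1 - oneSubRpowNeg (-ν)) ^ N)

lemma sibuyaCoeff_nonneg {ν β : ℝ} (h0 : 0 ≤ ν) (h1 : ν ≤ 1) (hβ : 0 ≤ β) (N k : ℕ) :
    0 ≤ sibuyaCoeff ν β N k :=
  coeff_mul_nonneg (coeff_oneSubRpowNeg_nonneg hβ)
    (coeff_pow_nonneg (coeff_one_sub_oneSubRpowNeg_nonneg h0 h1) N) k

lemma sibuyaCoeff_eq_sum (ν β : ℝ) (N k : ℕ) :
    sibuyaCoeff ν β N k = ∑ j ∈ Finset.range (N + 1),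
      (-1) ^ j * N.choose j * ∏ i ∈ Finset.range k, (β - ν * j + i) / (i + 1) := by
  have h : oneSubRpowNeg β * (1 - oneSubRpowNeg (-ν)) ^ N = ∑ j ∈ Finset.range (N + 1),
      C ((-1) ^ j * (N.choose j : ℝ)) * oneSubRpowNeg (β - ν * j) := by
    rw [sub_eq_neg_add, add_pow, Finset.mul_sum]
    refine Finset.sum_congr rfl fun j _ => ?_
    rw [show β - ν * j = β + j * (-ν) by ring, oneSubRpowNeg_add, ← oneSubRpowNeg_pow, neg_pow]
    simp
    ring
  rw [sibuyaCoeff, h, map_sum]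
  refine Finset.sum_congr rfl fun j _ => ?_
  rw [coeff_C_mul, coeff_oneSubRpowNeg]

lemma antitone_sibuyaCoeff_one {ν : ℝ} (h0 : 0 ≤ ν) (h1 : ν ≤ 1) (k : ℕ) :
    Antitone fun N => sibuyaCoeff ν 1 N k := by
  refine antitone_nat_of_succ_le fun N => ?_
  have h : oneSubRpowNeg 1 * (1 - oneSubRpowNeg (-ν)) ^ N =
      oneSubRpowNeg 1 * (1 - oneSubRpowNeg (-ν)) ^ (N + 1) +
      oneSubRpowNeg (1 - ν) * (1 - oneSubRpowNeg (-ν)) ^ N := by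
    rw [sub_eq_add_neg 1 ν, oneSubRpowNeg_add]; ring
  have h2 := sibuyaCoeff_nonneg h0 h1 (sub_nonneg.2 h1) N k
  simp only [sibuyaCoeff] at h2 ⊢
  rw [h, map_add]
  linarith

lemma mul_sibuyaCoeff_one_le {ν : ℝ} (h0 : 0 ≤ ν) (h1 : ν ≤ 1) (N k : ℕ) :
    N * sibuyaCoeff ν 1 N k ≤ coeff k (oneSubRpowNeg (1 + ν)) := by
  have h : oneSubRpowNeg (1 + ν) = (∑ i ∈ Finset.range N, oneSubRpowNeg 1 *
      (1 - oneSubRpowNeg (-ν)) ^ i) + oneSubRpowNeg (1 + ν) * (1 - oneSubRpowNeg (-ν)) ^ N := by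
    have e : oneSubRpowNeg 1 = oneSubRpowNeg (1 + ν) * (1 - (1 - oneSubRpowNeg (-ν))) := by
      rw [sub_sub_cancel, ← oneSubRpowNeg_add]; ring_nf
    rw [← Finset.mul_sum, e, mul_assoc, mul_neg_geom_sum]; ring
  have h2 := sibuyaCoeff_nonneg h0 h1 (β := 1 + ν) (by linarith) N k
  have h3 : ∑ i ∈ Finset.range N, sibuyaCoeff ν 1 N k ≤ ∑ i ∈ Finset.range N, sibuyaCoeff ν 1 i k :=
    Finset.sum_le_sum fun i hi => antitone_sibuyaCoeff_one h0 h1 k (Finset.mem_range.1 hi).le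
  rw [Finset.sum_const, Finset.card_range, nsmul_eq_mul] at h3
  rw [h, map_add, map_sum]
  simp only [sibuyaCoeff] at h2 h3 ⊢
  linarith

lemma abs_prod_mul_rpow_le {b : ℝ} (hb : 0 ≤ b) (k : ℕ) :
    |∏ i ∈ Finset.range k, (1 - b + i) / (i + 1)| * ((k : ℝ) + 1) ^ b ≤ (2 * b + 2) ^ b := by
  set m := ⌊b⌋₊ with hm
  have hmb : (m : ℝ) ≤ b := Nat.floor_le hb
  have hbm : b < m + 1 := Nat.lt_floor_add_one b
  have h1 : ∀ k ≤ m, |∏ i ∈ Finset.range k, (1 - b + i) / ((i : ℝ) + 1)| ≤ m.choose k := by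
    intro k
    induction k with
    | zero => simp
    | succ k ih =>
      intro hk
      have hk' : (k : ℝ) + 1 ≤ m := by exact_mod_cast hk
      have hc : ((m.choose (k + 1) : ℕ) : ℝ) = m.choose k * ((m - k) / (k + 1)) := by
        have := Nat.choose_succ_right_eq m k
        have h2 : ((m.choose (k + 1) : ℕ) : ℝ) * (k + 1) = m.choose k * (m - k) := by
          rw [← Nat.cast_sub (by omega)]; exact_mod_cast this
        field_simp
        linarith
      rw [Finset.prod_range_succ, abs_mul, hc]
      refine mul_le_mul (ih (by omega)) ?_ (abs_nonneg _) (by positivity)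
      rw [abs_div, abs_of_pos (show (0 : ℝ) < (k : ℝ) + 1 by positivity)]
      gcongr
      rw [abs_le]; constructor <;> linarith
  have hmm : ((m : ℝ) + 1) ^ b ≤ (b + 1) ^ b := by gcongr
  have h2 : (2 * b + 2) ^ b = 2 ^ b * (b + 1) ^ b := by
    rw [← Real.mul_rpow (by norm_num) (by linarith)]; ring_nf
  rcases le_total k m with hk | hk
  · rw [h2]
    have h3 : ((m.choose k : ℕ) : ℝ) ≤ 2 ^ b :=
      calc ((m.choose k : ℕ) : ℝ) ≤ (2 : ℝ) ^ m := by exact_mod_cast Nat.choose_le_two_pow m k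
        _ = (2 : ℝ) ^ (m : ℝ) := (Real.rpow_natCast _ _).symm
        _ ≤ 2 ^ b := Real.rpow_le_rpow_of_exponent_le (by norm_num) hmb
    have h4 : ((k : ℝ) + 1) ^ b ≤ (b + 1) ^ b := by
      have : (k : ℝ) ≤ m := by exact_mod_cast hk
      gcongr; linarith
    exact mul_le_mul ((h1 k hk).trans h3) h4 (by positivity) (by positivity)
  · have h5 : |∏ i ∈ Finset.range k, (1 - b + i) / ((i : ℝ) + 1)| * ((k : ℝ) + 1) ^ b
        ≤ ((m : ℝ) + 1) ^ b := by
      induction k, hk using Nat.le_induction with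
      | base =>
        have := h1 m le_rfl
        rw [Nat.choose_self, Nat.cast_one] at this
        exact mul_le_of_le_one_left (by positivity) this
      | succ k hk ih =>
        refine le_trans ?_ ih
        have hk' : (m : ℝ) ≤ k := by exact_mod_cast hk
        rw [Finset.prod_range_succ, abs_mul, mul_assoc]
        refine mul_le_mul_of_nonneg_left ?_ (abs_nonneg _)
        have hp : (0 : ℝ) < (k : ℝ) + 1 := by positivity
        rw [abs_of_nonneg (div_nonneg (by linarith) hp.le)]
        have e1 : (1 - b + k) / ((k : ℝ) + 1) ≤ Real.exp (-(b / (k + 1))) := by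
          refine le_trans (le_of_eq ?_) (Real.add_one_le_exp _)
          field_simp; ring
        have e2 : (((k + 1 : ℕ) : ℝ) + 1) ^ b ≤ Real.exp (b / (k + 1)) * ((k : ℝ) + 1) ^ b := by
          have : ((k + 1 : ℕ) : ℝ) + 1 ≤ Real.exp (1 / (k + 1)) * ((k : ℝ) + 1) := by
            have := mul_le_mul_of_nonneg_right (Real.add_one_le_exp (1 / ((k : ℝ) + 1))) hp.le
            refine le_trans (le_of_eq ?_) this
            push_cast; field_simp; ring
          calc (((k + 1 : ℕ) : ℝ) + 1) ^ b ≤ (Real.exp (1 / (k + 1)) * ((k : ℝ) + 1)) ^ b := by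
                gcongr
            _ = _ := by
              rw [Real.mul_rpow (by positivity) (by positivity), ← Real.exp_mul]; ring_nf
        calc _ ≤ Real.exp (-(b / (k + 1))) * (Real.exp (b / (k + 1)) * ((k : ℝ) + 1) ^ b) :=
              mul_le_mul e1 e2 (by positivity) (by positivity)
          _ = _ := by rw [← mul_assoc, ← Real.exp_add]; simp
    refine h5.trans (hmm.trans ?_)
    gcongr <;> linarith

lemma tendsto_prod_mul_rpow (a : ℝ) :
    Tendsto (fun k : ℕ => (∏ i ∈ Finset.range k, (a + i) / ((i : ℝ) + 1)) * (k : ℝ) ^ (1 - a)) atTop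
      (𝓝 (Real.Gamma a)⁻¹) := by
  have hfac (k : ℕ) : (Nat.factorial k : ℝ) = ∏ i ∈ Finset.range k, ((i : ℝ) + 1) := by
    rw [← Finset.prod_range_add_one_eq_factorial]; push_cast; rfl
  by_cases hG : Real.Gamma a = 0
  · obtain ⟨m, rfl⟩ := (Real.Gamma_eq_zero_iff a).1 hG
    rw [hG, inv_zero]
    refine tendsto_const_nhds.congr' ?_
    filter_upwards [eventually_gt_atTop m] with k hk
    rw [Finset.prod_eq_zero (Finset.mem_range.2 hk) (by simp), zero_mul]
  · have h1 := ((Real.GammaSeq_tendsto_Gamma a).inv₀ hG)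
    have h2 : Tendsto (fun k : ℕ => 1 + a / (k : ℝ)) atTop (𝓝 (1 + 0)) :=
      tendsto_const_nhds.add (tendsto_const_div_atTop_nhds_zero_nat a)
    have h3 := h1.div h2 (by norm_num)
    rw [add_zero, div_one] at h3
    refine h3.congr' ?_
    filter_upwards [eventually_gt_atTop 0, eventually_gt_atTop ⌈-a⌉₊] with k hk hk2
    have hk' : (0 : ℝ) < k := by exact_mod_cast hk
    have hka : 0 < a + k := by have := Nat.lt_of_ceil_lt hk2; linarith
    simp only [Pi.div_apply, Real.GammaSeq]
    rw [Finset.prod_range_succ, Finset.prod_div_distrib, ← hfac, Real.rpow_sub hk', Real.rpow_one]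
    have := (Real.rpow_pos_of_pos hk' a).ne'
    have := Nat.factorial_ne_zero k
    have e : 1 + a / (k : ℝ) = (a + k) / k := by field_simp; ring
    rw [e]
    field_simp

/-- A majorant for the reciprocal Gamma coefficients of the Wright series. -/
noncomputable def wrightBound (ν : ℝ) (j : ℕ) : ℝ := (2 * j + 4) ^ (1 + ν * j)

lemma wrightBound_nonneg (ν : ℝ) (j : ℕ) : 0 ≤ wrightBound ν j := by
  unfold wrightBound; positivity

lemma abs_prod_mul_rpow_le_wrightBound {ν β : ℝ} (h0 : 0 ≤ ν) (h1 : ν ≤ 1) (hβ0 : 0 ≤ β)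
    (hβ1 : β ≤ 1) (j k : ℕ) :
    |∏ i ∈ Finset.range k, (β - ν * j + i) / ((i : ℝ) + 1)| * (k : ℝ) ^ (1 - (β - ν * j)) ≤
      wrightBound ν j := by
  have hj : 0 ≤ ν * j := by positivity
  have hj1 : ν * j ≤ j := mul_le_of_le_one_left (by positivity) h1
  have hb : 0 ≤ 1 - (β - ν * j) := by linarith
  have h := abs_prod_mul_rpow_le hb k
  rw [sub_sub_cancel] at h
  refine le_trans (mul_le_mul_of_nonneg_left ?_ (abs_nonneg _)) (h.trans ?_)
  · gcongr; linarith
  · unfold wrightBound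
    calc _ ≤ (2 * (j : ℝ) + 4) ^ (1 - (β - ν * j)) :=
        Real.rpow_le_rpow (by linarith) (by linarith) hb
      _ ≤ _ := Real.rpow_le_rpow_of_exponent_le (by linarith [Nat.cast_nonneg (α := ℝ) j])
        (by linarith)

lemma abs_inv_Gamma_le {ν β : ℝ} (h0 : 0 ≤ ν) (h1 : ν ≤ 1) (hβ0 : 0 ≤ β) (hβ1 : β ≤ 1) (j : ℕ) :
    |(Real.Gamma (β - ν * j))⁻¹| ≤ wrightBound ν j := by
  refine le_of_tendsto (tendsto_prod_mul_rpow (β - ν * j)).abs (Eventually.of_forall fun k => ?_)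
  rw [abs_mul, abs_of_nonneg (Real.rpow_nonneg (Nat.cast_nonneg k) _)]
  exact abs_prod_mul_rpow_le_wrightBound h0 h1 hβ0 hβ1 j k

lemma summable_pow_mul_wrightBound {ν : ℝ} (h1 : ν < 1) {x : ℝ} (hx : 0 ≤ x) :
    Summable fun j : ℕ => x ^ j / j.factorial * wrightBound ν j := by
  have hlim : Tendsto (fun j : ℕ => x * Real.exp 1 * 2 ^ ν * ((j : ℝ) + 2) ^ (-(1 - ν)))
      atTop (𝓝 (x * Real.exp 1 * 2 ^ ν * 0)) :=
    ((tendsto_rpow_neg_atTop (sub_pos.2 h1)).comp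
      (tendsto_atTop_add_const_right _ _ tendsto_natCast_atTop_atTop)).const_mul _
  rw [mul_zero] at hlim
  refine summable_of_isBigO_nat (g := fun j : ℕ => (1 / 2 : ℝ) ^ j) summable_geometric_two ?_
  refine Asymptotics.IsBigO.of_bound (4 * Real.exp 2) ?_
  filter_upwards [hlim.eventually_le_const (show (0 : ℝ) < 1 / 4 by norm_num)] with j hj
  have hp : (0 : ℝ) < (j : ℝ) + 2 := by positivity
  have hB := wrightBound_nonneg ν j
  rw [Real.norm_of_nonneg (by positivity), Real.norm_of_nonneg (by positivity)]
  have e1 : wrightBound ν j = 2 * ((j : ℝ) + 2) * (2 ^ ν * ((j : ℝ) + 2) ^ ν) ^ j := by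
    rw [wrightBound, Real.rpow_add (by positivity), Real.rpow_one, Real.rpow_mul (by positivity),
      Real.rpow_natCast, ← Real.mul_rpow (by norm_num) hp.le]
    ring_nf
  have e2 : 1 / (j.factorial : ℝ) ≤ Real.exp 2 * Real.exp 1 ^ j / ((j : ℝ) + 2) ^ j := by
    rw [← Real.exp_nat_mul, mul_one, ← Real.exp_add, le_div_iff₀ (by positivity), add_comm 2,
      one_div_mul_eq_div]
    exact Real.pow_div_factorial_le_exp _ hp.le j
  have e3 : (j : ℝ) + 2 ≤ 2 * 2 ^ j := by
    have : j + 1 ≤ 2 ^ j := Nat.lt_two_pow_self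
    have h2 : j + 2 ≤ 2 * 2 ^ j := by omega
    exact_mod_cast h2
  have e4 : ((j : ℝ) + 2) ^ (-(1 - ν)) = ((j : ℝ) + 2) ^ ν / (j + 2) := by
    rw [neg_sub, Real.rpow_sub hp, Real.rpow_one]
  calc x ^ j / j.factorial * wrightBound ν j
      = (1 / j.factorial) * (x ^ j * wrightBound ν j) := by ring
    _ ≤ (Real.exp 2 * Real.exp 1 ^ j / ((j : ℝ) + 2) ^ j) * (x ^ j * wrightBound ν j) := by gcongr
    _ = 2 * Real.exp 2 * ((j : ℝ) + 2) *
        (x * Real.exp 1 * 2 ^ ν * ((j : ℝ) + 2) ^ (-(1 - ν))) ^ j := by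
      rw [e1, e4]; simp only [mul_pow, div_pow]; ring
    _ ≤ 2 * Real.exp 2 * (2 * 2 ^ j) * (1 / 4) ^ j := by gcongr
    _ = 4 * Real.exp 2 * (1 / 2) ^ j := by
      rw [show (1 / 4 : ℝ) = 1 / 2 * (1 / 2) by norm_num, mul_pow, ← mul_assoc, mul_right_comm]
      have : (2 : ℝ) ^ j * (1 / 2) ^ j = 1 := by rw [← mul_pow]; norm_num
      linear_combination 4 * Real.exp 2 * (1 / 2) ^ j * this

/-- The Wright function `W(x) = ∑ (-x) ^ j / (j! Γ(β - ν j))`. -/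
noncomputable def wright (ν β x : ℝ) : ℝ :=
  ∑' j : ℕ, (-x) ^ j / j.factorial * (Real.Gamma (β - ν * j))⁻¹

lemma tendsto_choose_div_pow {u : ℕ → ℝ} {n : ℕ → ℕ} {x : ℝ}
    (hn : Tendsto n atTop atTop) (h : Tendsto (fun k => n k / u k) atTop (𝓝 x)) (j : ℕ) :
    Tendsto (fun k => ((n k).choose j : ℝ) / u k ^ j) atTop (𝓝 (x ^ j / j.factorial)) := by
  have h1 := ((isEquivalent_choose j).comp_tendsto hn).symm
  have h2 : Tendsto (fun k => ((n k : ℝ) ^ j / j.factorial) / u k ^ j) atTop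
      (𝓝 (x ^ j / j.factorial)) := by
    refine ((h.pow j).div_const _).congr fun k => ?_
    rw [div_pow]; ring
  exact (h1.div Asymptotics.IsEquivalent.refl).tendsto_nhds h2

lemma tendsto_sibuyaCoeff {ν β x : ℝ} (h0 : 0 < ν) (h1 : ν < 1) (hβ0 : 0 ≤ β) (hβ1 : β ≤ 1)
    (hx : 0 < x) :
    Tendsto (fun k : ℕ => sibuyaCoeff ν β ⌊x * (k : ℝ) ^ ν⌋₊ k * (k : ℝ) ^ (1 - β)) atTop
      (𝓝 (wright ν β x)) := by
  have hu : Tendsto (fun k : ℕ => (k : ℝ) ^ ν) atTop atTop :=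
    (tendsto_rpow_atTop h0).comp tendsto_natCast_atTop_atTop
  have hn : Tendsto (fun k : ℕ => ⌊x * (k : ℝ) ^ ν⌋₊) atTop atTop :=
    tendsto_nat_floor_atTop.comp (hu.const_mul_atTop hx)
  have hr : Tendsto (fun k : ℕ => (⌊x * (k : ℝ) ^ ν⌋₊ : ℝ) / (k : ℝ) ^ ν) atTop (𝓝 x) :=
    (tendsto_nat_floor_mul_div_atTop hx.le).comp hu
  let f : ℕ → ℕ → ℝ := fun k j => ((-1) ^ j * ((⌊x * (k : ℝ) ^ ν⌋₊.choose j : ℝ) /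
    ((k : ℝ) ^ ν) ^ j)) * ((∏ i ∈ Finset.range k, (β - ν * j + i) / ((i : ℝ) + 1)) *
      (k : ℝ) ^ (1 - (β - ν * j)))
  have hf : ∀ᶠ k : ℕ in atTop, ∑' j, f k j =
      sibuyaCoeff ν β ⌊x * (k : ℝ) ^ ν⌋₊ k * (k : ℝ) ^ (1 - β) := by
    filter_upwards [eventually_gt_atTop 0] with k hk
    have hk' : (0 : ℝ) < k := by exact_mod_cast hk
    rw [tsum_eq_sum (s := Finset.range (⌊x * (k : ℝ) ^ ν⌋₊ + 1)), sibuyaCoeff_eq_sum, Finset.sum_mul]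
    · refine Finset.sum_congr rfl fun j _ => ?_
      have e : (k : ℝ) ^ (1 - (β - ν * j)) = (k : ℝ) ^ (1 - β) * ((k : ℝ) ^ ν) ^ j := by
        rw [← Real.rpow_natCast, ← Real.rpow_mul hk'.le, ← Real.rpow_add hk']; ring_nf
      have : ((k : ℝ) ^ ν) ^ j ≠ 0 := (pow_pos (Real.rpow_pos_of_pos hk' _) _).ne'
      simp only [f]
      rw [e]
      field_simp
    · intro j hj
      rw [Finset.mem_range, not_lt] at hj
      simp [f, Nat.choose_eq_zero_of_lt (show ⌊x * (k : ℝ) ^ ν⌋₊ < j by omega)]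
  refine Tendsto.congr' hf ?_
  refine tendsto_tsum_of_dominated_convergence (summable_pow_mul_wrightBound h1 hx.le)
    (fun j => ?_) ?_
  · have := (((tendsto_choose_div_pow hn hr j).const_mul ((-1) ^ j)).mul
      (tendsto_prod_mul_rpow (β - ν * j)))
    rwa [← mul_div_assoc, ← neg_pow] at this
  · filter_upwards [eventually_gt_atTop 0] with k hk j
    have hk' : (0 : ℝ) < (k : ℝ) ^ ν := Real.rpow_pos_of_pos (by exact_mod_cast hk) _
    simp only [f, norm_mul, norm_pow, norm_neg, norm_one, one_pow, one_mul]
    refine mul_le_mul ?_ ?_ (by positivity) (by positivity)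
    · rw [Real.norm_of_nonneg (by positivity), div_le_iff₀ (by positivity)]
      calc _ ≤ (⌊x * (k : ℝ) ^ ν⌋₊ : ℝ) ^ j / j.factorial := Nat.choose_le_pow_div _ _
        _ ≤ (x * (k : ℝ) ^ ν) ^ j / j.factorial := by
          gcongr; exact Nat.floor_le (by positivity)
        _ = _ := by rw [mul_pow]; ring
    · rw [Real.norm_eq_abs, Real.norm_of_nonneg (by positivity)]
      exact abs_prod_mul_rpow_le_wrightBound h0.le h1.le hβ0 hβ1 j k

lemma antitoneOn_wright_one {ν : ℝ} (h0 : 0 < ν) (h1 : ν < 1) :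
    AntitoneOn (wright ν 1) (Set.Ioi 0) := by
  intro x hx y hy hxy
  refine le_of_tendsto_of_tendsto' (tendsto_sibuyaCoeff h0 h1 zero_le_one le_rfl hy)
    (tendsto_sibuyaCoeff h0 h1 zero_le_one le_rfl hx) fun k => ?_
  refine mul_le_mul_of_nonneg_right (antitone_sibuyaCoeff_one h0.le h1.le k ?_) (by positivity)
  gcongr

lemma mul_wright_one_le {ν x : ℝ} (h0 : 0 < ν) (h1 : ν < 1) (hx : 0 < x) :
    x * wright ν 1 x ≤ (Real.Gamma (1 + ν))⁻¹ := by
  have hu : Tendsto (fun k : ℕ => (k : ℝ) ^ ν) atTop atTop :=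
    (tendsto_rpow_atTop h0).comp tendsto_natCast_atTop_atTop
  have hr : Tendsto (fun k : ℕ => (⌊x * (k : ℝ) ^ ν⌋₊ : ℝ) / (k : ℝ) ^ ν) atTop (𝓝 x) :=
    (tendsto_nat_floor_mul_div_atTop hx.le).comp hu
  refine le_of_tendsto_of_tendsto (hr.mul (tendsto_sibuyaCoeff h0 h1 zero_le_one le_rfl hx))
    (tendsto_prod_mul_rpow (1 + ν)) ?_
  filter_upwards [eventually_gt_atTop 0] with k hk
  have hk' : (0 : ℝ) < (k : ℝ) ^ ν := Real.rpow_pos_of_pos (by exact_mod_cast hk) _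
  have h := mul_sibuyaCoeff_one_le h0.le h1.le ⌊x * (k : ℝ) ^ ν⌋₊ k
  rw [coeff_oneSubRpowNeg] at h
  rw [sub_self, Real.rpow_zero, mul_one, sub_add_cancel_left, Real.rpow_neg (by positivity),
    div_mul_eq_mul_div, div_eq_mul_inv]
  gcongr

lemma summable_wright {ν β : ℝ} (h0 : 0 ≤ ν) (h1 : ν < 1) (hβ0 : 0 ≤ β) (hβ1 : β ≤ 1) {x : ℝ}
    (hx : 0 ≤ x) :
    Summable fun j : ℕ => x ^ j / j.factorial * |(Real.Gamma (β - ν * j))⁻¹| :=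
  Summable.of_nonneg_of_le (fun j => by positivity)
    (fun j => mul_le_mul_of_nonneg_left (abs_inv_Gamma_le h0 h1.le hβ0 hβ1 j) (by positivity))
    (summable_pow_mul_wrightBound h1 hx)

lemma analyticOnNhd_wright {ν β : ℝ} (h0 : 0 ≤ ν) (h1 : ν < 1) (hβ0 : 0 ≤ β) (hβ1 : β ≤ 1) :
    AnalyticOnNhd ℝ (wright ν β) Set.univ := by
  let c : ℕ → ℝ := fun j => (-1) ^ j / j.factorial * (Real.Gamma (β - ν * j))⁻¹
  have hr : (FormalMultilinearSeries.ofScalars ℝ c).radius = ⊤ := by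
    refine FormalMultilinearSeries.radius_eq_top_of_summable_norm _ fun r => ?_
    refine (summable_wright h0 h1 hβ0 hβ1 r.2).congr fun j => ?_
    rw [FormalMultilinearSeries.ofScalars_norm]
    simp only [c, norm_mul, norm_div, norm_pow, norm_neg, norm_one, one_pow, Real.norm_eq_abs,
      Nat.abs_cast]
    simp only [NNReal.val_eq_coe]
    ring
  have h := ((FormalMultilinearSeries.ofScalars ℝ c).hasFPowerSeriesOnBall
    (by rw [hr]; exact ENNReal.zero_lt_top)).analyticOnNhd
  rw [hr, Metric.eball_top] at h
  have e : (FormalMultilinearSeries.ofScalars ℝ c).sum = wright ν β := by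
    funext x
    refine (FormalMultilinearSeries.ofScalars_sum_eq c x).trans (tsum_congr fun j => ?_)
    rw [smul_eq_mul, neg_pow x]
    simp only [c]
    ring
  rwa [e] at h

lemma wright_one_zero (ν : ℝ) : wright ν 1 0 = 1 := by
  rw [wright, tsum_eq_single 0 (fun j hj => by simp [hj])]
  simp

lemma mainardi_eq_wright (ν : ℝ) : mainardi ν = wright ν (1 - ν) := by
  funext x
  exact tsum_congr fun j => by rw [← div_div, div_eq_mul_inv]

lemma integral_mainardi {ν m : ℝ} (h0 : 0 ≤ ν) (h1 : ν < 1) (hm : 0 ≤ m) :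
    ∫ u in (0 : ℝ)..m, mainardi ν u = 1 - wright ν 1 m := by
  have hs : Summable fun j : ℕ => (-m) ^ j / j.factorial * (Real.Gamma (1 - ν * j))⁻¹ := by
    refine Summable.of_norm ((summable_wright h0 h1 zero_le_one le_rfl hm).congr fun j => ?_)
    simp [abs_of_nonneg hm]
  let f : ℕ → C(ℝ, ℝ) := fun j =>
    ⟨fun x => (-x) ^ j / j.factorial * (Real.Gamma (1 - ν - ν * j))⁻¹, by fun_prop⟩
  have hf : Summable fun j => ‖(f j).restrict (⟨Set.uIcc 0 m, isCompact_uIcc⟩ :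
      TopologicalSpace.Compacts ℝ)‖ := by
    refine Summable.of_nonneg_of_le (fun j => norm_nonneg _) (fun j => ?_)
      (summable_wright h0 h1 (sub_nonneg.2 h1.le) (sub_le_self 1 h0) hm)
    refine (ContinuousMap.norm_le _ (by positivity)).2 fun x => ?_
    obtain ⟨x, hx⟩ := x
    change x ∈ Set.uIcc 0 m at hx
    rw [Set.uIcc_of_le hm] at hx
    simp only [f, ContinuousMap.restrict_apply, ContinuousMap.coe_mk, norm_mul, norm_div, norm_pow,
      norm_neg, Real.norm_eq_abs, Nat.abs_cast, abs_of_nonneg hx.1]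
    gcongr
    · exact hx.1
    · exact hx.2
  have h := intervalIntegral.hasSum_intervalIntegral_of_summable_norm hf
  have hi : ∀ j, ∫ x in (0 : ℝ)..m, f j x =
      -((-m) ^ (j + 1) / (j + 1).factorial * (Real.Gamma (1 - ν * (j + 1 : ℕ)))⁻¹) := by
    intro j
    have e : 1 - ν * (j + 1 : ℕ) = 1 - ν - ν * j := by push_cast; ring
    have e2 : ∫ x in (0 : ℝ)..m, (-x) ^ j = -((-m) ^ (j + 1) / (j + 1)) := by
      rw [intervalIntegral.integral_comp_neg fun x : ℝ => x ^ j, integral_pow]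
      simp
      ring
    simp only [f, ContinuousMap.coe_mk]
    rw [intervalIntegral.integral_mul_const, intervalIntegral.integral_div, e2, e,
      Nat.factorial_succ]
    push_cast
    field_simp
  simp only [hi] at h
  have h2 : wright ν 1 m = _ := hs.tsum_eq_zero_add
  rw [h2, mainardi_eq_wright]
  refine h.tsum_eq.symm.trans ?_
  rw [tsum_neg]
  simp

theorem mainardi_median_exists_unique (ν : ℝ) (hν0 : 1 / 2 ≤ ν) (hν1 : ν < 1) :
    ∃! m : ℝ, 0 < m ∧ ∫ u in (0 : ℝ)..m, mainardi ν u = 1 / 2 := by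
  have h0 : 0 < ν := by linarith
  have han := analyticOnNhd_wright h0.le hν1 zero_le_one le_rfl
  have hanti := antitoneOn_wright_one h0 hν1
  have hmed : ∀ m : ℝ, (0 < m ∧ ∫ u in (0 : ℝ)..m, mainardi ν u = 1 / 2) ↔
      0 < m ∧ wright ν 1 m = 1 / 2 := fun m =>
    and_congr_right fun hm => by
      rw [integral_mainardi h0.le hν1 hm.le]; constructor <;> intro h <;> linarith
  have hne : ∀ a b : ℝ, 0 < a → wright ν 1 a = 1 / 2 → wright ν 1 b = 1 / 2 → ¬ a < b := by
    intro a b ha hwa hwb hab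
    have hconst : ∀ x ∈ Set.Ioo a b, wright ν 1 x = 1 / 2 := fun x hx =>
      le_antisymm (hwa ▸ hanti ha (ha.trans hx.1) hx.1.le)
        (hwb ▸ hanti (ha.trans hx.1) (ha.trans hab) hx.2.le)
    have hmid : (a + b) / 2 ∈ Set.Ioo a b := ⟨by linarith, by linarith⟩
    have h := han.eqOn_of_preconnected_of_eventuallyEq (g := fun _ => 1 / 2)
      analyticOnNhd_const isPreconnected_univ (Set.mem_univ _)
      (Filter.eventually_of_mem (Ioo_mem_nhds hmid.1 hmid.2) hconst) (Set.mem_univ 0)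
    rw [wright_one_zero] at h
    norm_num at h
  obtain ⟨m, hm, hwm⟩ : ∃ m, 0 < m ∧ wright ν 1 m = 1 / 2 := by
    have hG : 0 < (Real.Gamma (1 + ν))⁻¹ := inv_pos.2 (Real.Gamma_pos_of_pos (by linarith))
    set M := 2 * (Real.Gamma (1 + ν))⁻¹ with hM
    have hM0 : 0 < M := by linarith
    have hle : wright ν 1 M ≤ 1 / 2 := by
      have h := mul_wright_one_le h0 hν1 hM0
      refine le_of_mul_le_mul_left ?_ hM0
      linarith
    obtain ⟨m, hm, hwm⟩ := intermediate_value_Icc' hM0.le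
      (han.continuousOn.mono (Set.subset_univ _)) ⟨hle, by rw [wright_one_zero]; norm_num⟩
    refine ⟨m, lt_of_le_of_ne hm.1 ?_, hwm⟩
    rintro rfl
    rw [wright_one_zero] at hwm
    norm_num at hwm
  refine ⟨m, (hmed m).2 ⟨hm, hwm⟩, fun y hy => ?_⟩
  obtain ⟨hy0, hwy⟩ := (hmed y).1 hy
  exact le_antisymm (not_lt.1 (hne m y hm hwm hwy)) (not_lt.1 (hne y m hy0 hwy hwm))
end

section
/- For every 0 < ν < 1 and every t > 0, the signaling Green function satisfies ∫₀^∞ G_s(r,t;ν) dr = ν t^{ν−1}/Γ(1+ν), the integral being convergent. -/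
open Real MeasureTheory Set

/-- The Green function of the signaling problem: `G_s(x,t;ν) = (ν x / t^{ν+1}) · M_ν(x/t^ν)`. -/
noncomputable def greenSignaling (ν x t : ℝ) : ℝ :=
  (ν * x / t ^ (ν + 1)) * mainardi ν (x / t ^ ν)

lemma norm_cexp_neg_mul_ofReal (r : ℂ) (u : ℝ) :
    ‖Complex.exp (-(r * u))‖ = Real.exp (-(r.re * u)) := by
  simp [Complex.norm_exp]

lemma integrableOn_rpow_mul_cexp_neg_mul {s : ℝ} (hs : -1 < s) {r : ℂ} (hr : 0 < r.re) :
    IntegrableOn (fun u : ℝ => ((u ^ s : ℝ) : ℂ) * Complex.exp (-(r * u))) (Ioi 0) := by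
  refine Integrable.mono' (integrableOn_rpow_mul_exp_neg_mul_rpow hs one_pos hr)
    (by fun_prop) ?_
  filter_upwards [ae_restrict_mem measurableSet_Ioi] with u hu
  have hu : 0 < u := hu
  rw [norm_mul, norm_cexp_neg_mul_ofReal, Complex.norm_real, Real.norm_of_nonneg (by positivity),
    Real.rpow_one, neg_mul]

lemma tendsto_rpow_mul_cexp_neg_mul (s : ℝ) {r : ℂ} (hr : 0 < r.re) :
    Filter.Tendsto (fun u : ℝ => ((u ^ s : ℝ) : ℂ) * Complex.exp (-(r * u)))
      Filter.atTop (nhds 0) := by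
  rw [tendsto_zero_iff_norm_tendsto_zero]
  refine (tendsto_rpow_mul_exp_neg_mul_atTop_nhds_zero s r.re hr).congr' ?_
  filter_upwards [Filter.eventually_gt_atTop 0] with u hu
  rw [norm_mul, norm_cexp_neg_mul_ofReal, Complex.norm_real, Real.norm_of_nonneg (by positivity),
    neg_mul]

lemma hasDerivAt_cexp_neg_mul_ofReal (r : ℂ) (u : ℝ) :
    HasDerivAt (fun u : ℝ => Complex.exp (-(r * u))) (-r * Complex.exp (-(r * u))) u := by
  have h : HasDerivAt (fun u : ℝ => -(r * (u : ℂ))) (-(r * 1)) u :=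
    ((Complex.ofRealCLM.hasDerivAt (x := u)).const_mul r).neg
  convert h.cexp using 1
  ring

lemma mul_integral_rpow_mul_cexp_neg_mul {s : ℝ} (hs : 0 < s) {r : ℂ} (hr : 0 < r.re) :
    r * ∫ u in Ioi (0 : ℝ), ((u ^ s : ℝ) : ℂ) * Complex.exp (-(r * u)) =
      s * ∫ u in Ioi (0 : ℝ), ((u ^ (s - 1) : ℝ) : ℂ) * Complex.exp (-(r * u)) := by
  have h1 := integrableOn_rpow_mul_cexp_neg_mul (s := s) (by linarith) hr
  have h2 := integrableOn_rpow_mul_cexp_neg_mul (s := s - 1) (by linarith) hr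
  have key := integral_Ioi_of_hasDerivAt_of_tendsto (a := 0) (m := (0 : ℂ))
    (f := fun u : ℝ => ((u ^ s : ℝ) : ℂ) * Complex.exp (-(r * u)))
    (f' := fun u : ℝ => s * (((u ^ (s - 1) : ℝ) : ℂ) * Complex.exp (-(r * u)))
      - r * (((u ^ s : ℝ) : ℂ) * Complex.exp (-(r * u))))
    (Continuous.continuousWithinAt (by
      have := Real.continuous_rpow_const hs.le
      fun_prop))
    (fun u (hu : 0 < u) => by
      refine ((Real.hasDerivAt_rpow_const (p := s) (Or.inl hu.ne')).ofReal_comp.mul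
        (hasDerivAt_cexp_neg_mul_ofReal r u)).congr_deriv ?_
      push_cast
      ring)
    ((h2.const_mul _).sub (h1.const_mul _)) (tendsto_rpow_mul_cexp_neg_mul s hr)
  rw [integral_sub (h2.const_mul _) (h1.const_mul _), integral_const_mul, integral_const_mul] at key
  simp only [Real.zero_rpow hs.ne', Complex.ofReal_zero, zero_mul, sub_zero] at key
  exact (sub_eq_zero.mp key).symm

lemma hasDerivAt_integral_rpow_mul_cexp_neg_mul {s : ℝ} (hs : -1 < s) {r : ℂ} (hr : 0 < r.re) :
    HasDerivAt (fun r : ℂ => ∫ u in Ioi (0 : ℝ), ((u ^ s : ℝ) : ℂ) * Complex.exp (-(r * u)))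
      (-∫ u in Ioi (0 : ℝ), ((u ^ (s + 1) : ℝ) : ℂ) * Complex.exp (-(r * u))) r := by
  rw [← integral_neg]
  refine (hasDerivAt_integral_of_dominated_loc_of_deriv_le (s := Metric.ball r (r.re / 2))
    (μ := volume.restrict (Ioi 0))
    (F := fun (r : ℂ) (u : ℝ) => ((u ^ s : ℝ) : ℂ) * Complex.exp (-(r * u)))
    (bound := fun u : ℝ => u ^ (s + 1) * Real.exp (-(r.re / 2) * u ^ (1 : ℝ)))
    (F' := fun (r : ℂ) (u : ℝ) => -(((u ^ (s + 1) : ℝ) : ℂ) * Complex.exp (-(r * u))))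
    (Metric.ball_mem_nhds _ (by linarith))
    (Filter.Eventually.of_forall fun z => by fun_prop)
    (integrableOn_rpow_mul_cexp_neg_mul hs hr)
    (by fun_prop) ?_
    (integrableOn_rpow_mul_exp_neg_mul_rpow (by linarith) one_pos (by linarith)) ?_).2
  · filter_upwards [ae_restrict_mem measurableSet_Ioi] with u hu z hz
    have hu : 0 < u := hu
    have hz' : |(z - r).re| < r.re / 2 :=
      (Complex.abs_re_le_norm _).trans_lt (by simpa [dist_eq_norm] using hz)
    rw [Complex.sub_re, abs_lt] at hz'
    rw [norm_neg, norm_mul, norm_cexp_neg_mul_ofReal, Complex.norm_real,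
      Real.norm_of_nonneg (by positivity), Real.rpow_one]
    gcongr
    nlinarith
  · filter_upwards [ae_restrict_mem measurableSet_Ioi] with u hu z _
    have hu : 0 < u := hu
    have h : HasDerivAt (fun z : ℂ => -(z * (u : ℂ))) (-(1 * (u : ℂ))) z :=
      ((hasDerivAt_id z).mul_const (u : ℂ)).neg
    refine (h.cexp.const_mul ((u ^ s : ℝ) : ℂ)).congr_deriv ?_
    rw [Real.rpow_add_one hu.ne']
    push_cast
    ring

/-- The Gamma integral with a complex rate in the right half plane. -/
lemma integral_rpow_mul_cexp_neg_mul {s : ℝ} (hs : 0 < s) {r : ℂ} (hr : 0 < r.re) :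
    ∫ u in Ioi (0 : ℝ), ((u ^ (s - 1) : ℝ) : ℂ) * Complex.exp (-(r * u)) =
      Real.Gamma s * r ^ (-s : ℂ) := by
  set F : ℂ → ℂ := fun r => ∫ u in Ioi (0 : ℝ), ((u ^ (s - 1) : ℝ) : ℂ) * Complex.exp (-(r * u))
    with hF
  have hd : ∀ z ∈ {z : ℂ | 0 < z.re}, HasDerivAt (fun z => z ^ (s : ℂ) * F z) 0 z := by
    intro z (hz : 0 < z.re)
    have hz0 : z ≠ 0 := fun h => by simp [h] at hz
    have h1 := hasDerivAt_integral_rpow_mul_cexp_neg_mul (s := s - 1) (by linarith) hz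
    have h2 := (hasDerivAt_id z).cpow_const (c := (s : ℂ)) (Or.inl hz)
    refine (h2.mul h1).congr_deriv ?_
    have h3 := mul_integral_rpow_mul_cexp_neg_mul hs hz
    simp only [id_eq, sub_add_cancel, mul_one]
    have h4 : z ^ (s : ℂ) = z ^ ((s : ℂ) - 1) * z := by
      rw [Complex.cpow_sub _ _ hz0, Complex.cpow_one, div_mul_cancel₀ _ hz0]
    rw [h4]
    linear_combination -z ^ ((s : ℂ) - 1) * h3
  have hopen : IsOpen {z : ℂ | 0 < z.re} := isOpen_lt continuous_const Complex.continuous_re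
  have hc := hopen.is_const_of_deriv_eq_zero
    (convex_halfSpace_re_gt 0).isPreconnected
    (fun z hz => (hd z hz).differentiableAt.differentiableWithinAt)
    (fun z hz => (hd z hz).deriv) (x := r) (y := 1) hr (by simp)
  have h1 : F 1 = Real.Gamma s := by
    have := Real.integral_rpow_mul_exp_neg_mul_Ioi hs one_pos
    simp only [one_mul, div_one, Real.one_rpow] at this
    rw [← this, ← integral_complex_ofReal]
    simp [hF]
  have hr0 : r ≠ 0 := fun h => by simp [h] at hr
  simp only [h1, Complex.one_cpow, one_mul] at hc
  rw [← hc, Complex.cpow_neg]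
  have : r ^ (s : ℂ) ≠ 0 := by simp [Complex.cpow_eq_zero_iff, hr0]
  change F r = _
  field_simp

lemma norm_cexp_neg_sub_one_le_two {z : ℂ} (hz : 0 ≤ z.re) : ‖Complex.exp (-z) - 1‖ ≤ 2 := by
  have h : ‖Complex.exp (-z)‖ ≤ 1 := by simpa [Complex.norm_exp] using hz
  calc ‖Complex.exp (-z) - 1‖ ≤ ‖Complex.exp (-z)‖ + ‖(1 : ℂ)‖ := norm_sub_le _ _
    _ ≤ 2 := by rw [norm_one]; linarith

lemma norm_cexp_neg_sub_one_le {z : ℂ} (hz : 0 ≤ z.re) : ‖Complex.exp (-z) - 1‖ ≤ 2 * ‖z‖ := by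
  rcases le_total ‖z‖ 1 with h | h
  · simpa using Complex.norm_exp_sub_one_le (x := -z) (by simpa using h)
  · linarith [norm_cexp_neg_sub_one_le_two hz]

lemma integrableOn_rpow_mul_cexp_sub_one {ν : ℝ} (hν0 : 0 < ν) (hν1 : ν < 1) {r : ℂ}
    (hr : 0 < r.re) :
    IntegrableOn (fun u : ℝ => ((u ^ (-ν - 1) : ℝ) : ℂ) * (Complex.exp (-(r * u)) - 1))
      (Ioi 0) := by
  rw [← Ioc_union_Ioi_eq_Ioi zero_le_one]
  refine IntegrableOn.union ?_ ?_
  · have h : IntegrableOn (fun u : ℝ => 2 * ‖r‖ * u ^ (-ν)) (Ioc 0 1) :=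
      ((intervalIntegrable_iff_integrableOn_Ioc_of_le zero_le_one).mp
        (intervalIntegral.intervalIntegrable_rpow' (by linarith))).const_mul _
    refine Integrable.mono' h (by fun_prop) ?_
    filter_upwards [ae_restrict_mem measurableSet_Ioc] with u hu
    have hu0 : 0 < u := hu.1
    have hz : 0 ≤ (r * u).re := by simpa using (mul_pos hr hu0).le
    have h2 := norm_cexp_neg_sub_one_le hz
    rw [norm_mul, Complex.norm_real, Real.norm_of_nonneg hu0.le] at h2
    rw [norm_mul, Complex.norm_real, Real.norm_of_nonneg (by positivity)]
    calc u ^ (-ν - 1) * ‖Complex.exp (-(r * u)) - 1‖ ≤ u ^ (-ν - 1) * (2 * (‖r‖ * u)) := by gcongr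
      _ = 2 * ‖r‖ * u ^ (-ν) := by rw [Real.rpow_sub_one hu0.ne']; field_simp
  · have h : IntegrableOn (fun u : ℝ => 2 * u ^ (-ν - 1)) (Ioi 1) :=
      (integrableOn_Ioi_rpow_of_lt (by linarith) one_pos).const_mul _
    refine Integrable.mono' h (by fun_prop) ?_
    filter_upwards [ae_restrict_mem measurableSet_Ioi] with u hu
    have hu0 : 0 < u := one_pos.trans hu
    have hz : 0 ≤ (r * u).re := by simpa using (mul_pos hr hu0).le
    rw [norm_mul, Complex.norm_real, Real.norm_of_nonneg (by positivity), mul_comm]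
    gcongr
    exact norm_cexp_neg_sub_one_le_two hz

/-- The regularised Gamma integral at exponent `-ν`. -/
lemma integral_rpow_mul_cexp_sub_one {ν : ℝ} (hν0 : 0 < ν) (hν1 : ν < 1) {r : ℂ}
    (hr : 0 < r.re) :
    ∫ u in Ioi (0 : ℝ), ((u ^ (-ν - 1) : ℝ) : ℂ) * (Complex.exp (-(r * u)) - 1) =
      Real.Gamma (-ν) * r ^ (ν : ℂ) := by
  have h1 := integrableOn_rpow_mul_cexp_neg_mul (s := -ν) (by linarith) hr
  have h2 := integrableOn_rpow_mul_cexp_sub_one hν0 hν1 hr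
  have hν : -ν ≠ 0 := by linarith
  have hcont : ContinuousWithinAt
      (fun u : ℝ => ((u ^ (-ν) : ℝ) : ℂ) * (Complex.exp (-(r * u)) - 1)) (Ici 0) 0 := by
    unfold ContinuousWithinAt
    simp only [Real.zero_rpow hν, Complex.ofReal_zero, zero_mul]
    refine squeeze_zero_norm' (a := fun u : ℝ => 2 * ‖r‖ * u ^ (1 - ν)) ?_ ?_
    · filter_upwards [self_mem_nhdsWithin] with u hu
      rcases (show 0 ≤ u from hu).eq_or_lt with rfl | hu0
      · simp [Real.zero_rpow (show 1 - ν ≠ 0 by linarith)]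
      have hz : 0 ≤ (r * u).re := by simpa using (mul_pos hr hu0).le
      have h2 := norm_cexp_neg_sub_one_le hz
      rw [norm_mul, Complex.norm_real, Real.norm_of_nonneg hu0.le] at h2
      rw [norm_mul, Complex.norm_real, Real.norm_of_nonneg (by positivity)]
      calc u ^ (-ν) * ‖Complex.exp (-(r * u)) - 1‖ ≤ u ^ (-ν) * (2 * (‖r‖ * u)) := by gcongr
        _ = 2 * ‖r‖ * u ^ (1 - ν) := by
          rw [show 1 - ν = -ν + 1 by ring, Real.rpow_add_one hu0.ne']; ring
    · have h : Continuous fun u : ℝ => 2 * ‖r‖ * u ^ (1 - ν) := by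
        have := Real.continuous_rpow_const (show 0 ≤ 1 - ν by linarith)
        fun_prop
      simpa [Real.zero_rpow (show 1 - ν ≠ 0 by linarith)] using
        (h.tendsto 0).mono_left nhdsWithin_le_nhds
  have htop : Filter.Tendsto
      (fun u : ℝ => ((u ^ (-ν) : ℝ) : ℂ) * (Complex.exp (-(r * u)) - 1))
      Filter.atTop (nhds 0) := by
    refine squeeze_zero_norm' (a := fun u : ℝ => 2 * u ^ (-ν)) ?_
      (by simpa using (tendsto_rpow_neg_atTop hν0).const_mul 2)
    filter_upwards [Filter.eventually_gt_atTop 0] with u hu0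
    have hz : 0 ≤ (r * u).re := by simpa using (mul_pos hr hu0).le
    rw [norm_mul, Complex.norm_real, Real.norm_of_nonneg (by positivity), mul_comm]
    gcongr
    exact norm_cexp_neg_sub_one_le_two hz
  have key := integral_Ioi_of_hasDerivAt_of_tendsto (a := 0) (m := (0 : ℂ))
    (f' := fun u : ℝ =>
      (-ν : ℂ) * (((u ^ (-ν - 1) : ℝ) : ℂ) * (Complex.exp (-(r * u)) - 1))
      - r * (((u ^ (-ν) : ℝ) : ℂ) * Complex.exp (-(r * u))))
    hcont
    (fun u (hu : 0 < u) => by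
      refine ((Real.hasDerivAt_rpow_const (p := -ν) (Or.inl hu.ne')).ofReal_comp.mul
        ((hasDerivAt_cexp_neg_mul_ofReal r u).sub_const 1)).congr_deriv ?_
      push_cast
      ring)
    ((h2.const_mul _).sub (h1.const_mul _)) htop
  rw [integral_sub (h2.const_mul _) (h1.const_mul _), integral_const_mul,
    integral_const_mul] at key
  have hG := integral_rpow_mul_cexp_neg_mul (s := 1 - ν) (by linarith) hr
  rw [show 1 - ν - 1 = -ν by ring] at hG
  rw [hG] at key
  simp only [Real.zero_rpow hν, Complex.ofReal_zero, zero_mul, sub_zero] at key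
  have hΓ : Real.Gamma (1 - ν) = -ν * Real.Gamma (-ν) := by
    rw [← Real.Gamma_add_one hν, neg_add_eq_sub]
  have hr0 : r ≠ 0 := fun h => by simp [h] at hr
  have hpow : r ^ (-((1 - ν : ℝ) : ℂ)) * r = r ^ (ν : ℂ) := by
    nth_rewrite 2 [← Complex.cpow_one r]
    rw [← Complex.cpow_add _ _ hr0]
    congr 1
    push_cast
    ring
  rw [hΓ] at key
  push_cast at key hpow
  have hνc : (ν : ℂ) ≠ 0 := by exact_mod_cast hν0.ne'
  refine mul_left_cancel₀ (neg_ne_zero.mpr hνc) ?_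
  linear_combination key - ν * Real.Gamma (-ν) * hpow

lemma integrableOn_rpow_mul_cexp_neg_mul_rpow {ν : ℝ} (hν0 : 0 < ν) {w : ℂ} (hw : 0 < w.re) :
    IntegrableOn (fun u : ℝ => ((u ^ (ν - 1) : ℝ) : ℂ) * Complex.exp (-(w * (u ^ ν : ℝ))))
      (Ioi 0) := by
  refine Integrable.mono' (integrableOn_rpow_mul_exp_neg_mul_rpow (s := ν - 1) (by linarith)
    hν0 hw) (by fun_prop) ?_
  filter_upwards [ae_restrict_mem measurableSet_Ioi] with u hu
  have hu : 0 < u := hu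
  rw [norm_mul, norm_cexp_neg_mul_ofReal, Complex.norm_real, Real.norm_of_nonneg (by positivity),
    neg_mul]

lemma integral_rpow_mul_cexp_neg_mul_rpow {ν : ℝ} (hν0 : 0 < ν) {w : ℂ} (hw : 0 < w.re) :
    ∫ u in Ioi (0 : ℝ), ((u ^ (ν - 1) : ℝ) : ℂ) * Complex.exp (-(w * (u ^ ν : ℝ))) =
      (ν * w)⁻¹ := by
  have h := integral_comp_rpow_Ioi_of_pos (g := fun y : ℝ => Complex.exp (-(w * y))) hν0
  have h2 := integral_exp_mul_complex_Ioi (a := -w) (by simpa using hw) 0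
  simp only [neg_mul, Complex.ofReal_zero, mul_zero, Complex.exp_zero, neg_div_neg_eq] at h2
  rw [h2] at h
  simp only [Complex.real_smul, Complex.ofReal_mul, mul_assoc] at h
  rw [integral_const_mul] at h
  have hνc : (ν : ℂ) ≠ 0 := by exact_mod_cast hν0.ne'
  rw [mul_inv, eq_inv_mul_iff_mul_eq₀ hνc, h, one_div]

lemma integral_mul_cexp_neg_mul {w : ℂ} (hw : 0 < w.re) :
    ∫ x in Ioi (0 : ℝ), (x : ℂ) * Complex.exp (-(w * x)) = (w ^ 2)⁻¹ := by
  have h := integral_rpow_mul_cexp_neg_mul two_pos hw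
  norm_num [Complex.cpow_neg] at h
  simpa using h

lemma integrableOn_mul_cexp_neg_mul {w : ℂ} (hw : 0 < w.re) :
    IntegrableOn (fun x : ℝ => (x : ℂ) * Complex.exp (-(w * x))) (Ioi 0) := by
  simpa using integrableOn_rpow_mul_cexp_neg_mul (s := 1) (by norm_num) hw

/-- The `x`-moment of the regularised kernel is absolutely integrable over the quadrant. -/
lemma integrable_mul_kernel {ν : ℝ} (hν0 : 0 < ν) (hν1 : ν < 1) {r c : ℂ}
    (hr : 0 < r.re) (hc : 0 < c.re) :
    Integrable (Function.uncurry fun x u : ℝ =>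
      ((u ^ (ν - 1) : ℝ) : ℂ) * (Complex.exp (-(r * u)) - 1) *
        ((x : ℂ) * Complex.exp (-(c * (u ^ ν : ℝ) * x))))
      ((volume.restrict (Ioi 0)).prod (volume.restrict (Ioi 0))) := by
  have hpos : ∀ u : ℝ, 0 < u → 0 < (c * (u ^ ν : ℝ)).re := fun u hu => by
    rw [Complex.re_mul_ofReal]; positivity
  rw [integrable_prod_iff' (by unfold Function.uncurry; fun_prop)]
  constructor
  · filter_upwards [ae_restrict_mem measurableSet_Ioi] with u hu
    exact (integrableOn_mul_cexp_neg_mul (hpos u hu)).const_mul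
      (((u ^ (ν - 1) : ℝ) : ℂ) * (Complex.exp (-(r * u)) - 1))
  · refine ((integrableOn_rpow_mul_cexp_sub_one hν0 hν1 hr).norm.const_mul ((c.re ^ 2)⁻¹)).congr ?_
    filter_upwards [ae_restrict_mem measurableSet_Ioi] with u hu
    have hu : 0 < u := hu
    have hx : ∫ x in Ioi (0 : ℝ), ‖(x : ℂ) * Complex.exp (-(c * (u ^ ν : ℝ) * x))‖ =
        ((c.re * u ^ ν) ^ 2)⁻¹ := by
      have h := Real.integral_rpow_mul_exp_neg_mul_Ioi (a := 2) (r := c.re * u ^ ν) two_pos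
        (by positivity)
      rw [Real.Gamma_two, mul_one, Real.rpow_two, one_div, inv_pow] at h
      rw [← h]
      refine setIntegral_congr_fun measurableSet_Ioi fun x (hx : 0 < x) => ?_
      norm_num [norm_cexp_neg_mul_ofReal, abs_of_pos hx, -Complex.ofReal_mul]
    simp only [Function.uncurry, norm_mul _ (_ * Complex.exp _)]
    rw [integral_const_mul, hx, norm_mul, norm_mul, Complex.norm_real, Complex.norm_real,
      Real.norm_of_nonneg (by positivity), Real.norm_of_nonneg (by positivity),
      Real.rpow_sub_one hu.ne', Real.rpow_sub_one hu.ne', Real.rpow_neg hu.le]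
    field_simp

lemma integrableOn_rpow_mul_exp_sub_linear {ν : ℝ} (hν0 : 0 < ν) (hν1 : ν < 1) {a b : ℝ}
    (ha : 0 ≤ a) (hb : 0 < b) :
    IntegrableOn (fun u : ℝ => u ^ (ν - 1) * Real.exp (-(b * u)) * Real.exp (a * u ^ ν))
      (Ioi 0) := by
  set U : ℝ := (2 * a / b) ^ (1 - ν)⁻¹ with hU
  have hU0 : 0 ≤ U := by positivity
  have hbound : ∀ u : ℝ, 0 < u → a * u ^ ν ≤ b / 2 * u + a * U ^ ν := by
    intro u hu
    rcases le_total u U with h | h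
    · have : u ^ ν ≤ U ^ ν := by gcongr
      nlinarith [mul_pos hb hu]
    · have h1 : 2 * a / b ≤ u ^ (1 - ν) := by
        rw [← Real.rpow_inv_le_iff_of_pos (by positivity) hu.le (by linarith)]
        exact h
      have h2 : u ^ (1 - ν) * u ^ ν = u := by
        rw [← Real.rpow_add hu]; simp
      have h3 : 0 < u ^ ν := by positivity
      have h4 : 0 ≤ a * U ^ ν := by positivity
      rw [div_le_iff₀ hb] at h1
      nlinarith
  have h := (integrableOn_rpow_mul_exp_neg_mul_rpow (s := ν - 1) (by linarith) one_pos
    (half_pos hb)).mul_const (Real.exp (a * U ^ ν))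
  refine Integrable.mono' h (by fun_prop) ?_
  filter_upwards [ae_restrict_mem measurableSet_Ioi] with u hu
  have hu : 0 < u := hu
  rw [Real.norm_of_nonneg (by positivity), mul_assoc, mul_assoc, ← Real.exp_add, ← Real.exp_add,
    Real.rpow_one]
  refine mul_le_mul_of_nonneg_left (Real.exp_le_exp.mpr ?_) (by positivity)
  linarith [hbound u hu]

/-- The reflection formula in the form used for the coefficients of the Mainardi function. -/
lemma Gamma_mul_sin_pi_mul {s : ℝ} (hs : 0 < s) :
    Real.Gamma s * Real.sin (π * s) = π / Real.Gamma (1 - s) := by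
  have h := Real.Gamma_mul_Gamma_one_sub s
  have hΓ := (Real.Gamma_pos_of_pos hs).ne'
  rw [eq_div_of_mul_eq hΓ ((mul_comm _ _).trans h), div_div_eq_mul_div, div_div_eq_mul_div]
  field_simp

lemma re_cexp_sub_pi_pos {φ : ℝ} (hφ0 : π / 2 < φ) (hφ1 : φ ≤ π) :
    0 < (Complex.exp ((φ - π) * Complex.I)).re := by
  rw [← Complex.ofReal_sub, Complex.exp_ofReal_mul_I_re]
  exact Real.cos_pos_of_mem_Ioo ⟨by linarith, by linarith [Real.pi_pos]⟩

lemma log_cexp_sub_pi {φ : ℝ} (hφ0 : π / 2 < φ) (hφ1 : φ ≤ π) :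
    Complex.log (Complex.exp ((φ - π) * Complex.I)) = (φ - π) * Complex.I := by
  rw [Complex.log_exp] <;> simp <;> linarith [Real.pi_pos]

/-- Integrating the `n`-th term of the kernel expansion yields the `n`-th Mainardi term. -/
lemma integral_mainardi_term {ν φ : ℝ} (hν0 : 0 < ν) (hφ0 : π / 2 < φ) (hφ1 : φ ≤ π) (x : ℝ)
    (n : ℕ) :
    (∫ u in Ioi (0 : ℝ), Complex.exp (ν * φ * Complex.I) * (((u ^ (ν - 1) : ℝ) : ℂ) *
      Complex.exp (-(Complex.exp ((φ - π) * Complex.I) * u)) *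
      ((-(Complex.exp (ν * φ * Complex.I) * x * (u ^ ν : ℝ))) ^ n / (n.factorial : ℂ)))).im =
    π * ((-x) ^ n / ((n.factorial : ℝ) * Real.Gamma (1 - ν - ν * n))) := by
  set c := Complex.exp (ν * φ * Complex.I) with hc
  set r := Complex.exp ((φ - π) * Complex.I) with hr
  set s : ℝ := ν * (n + 1) with hs
  have hs0 : 0 < s := by positivity
  have hr0 : 0 < r.re := re_cexp_sub_pi_pos hφ0 hφ1
  have hlog : Complex.log r = (φ - π) * Complex.I := log_cexp_sub_pi hφ0 hφ1
  have h1 : ∀ u ∈ Ioi (0 : ℝ), c * (((u ^ (ν - 1) : ℝ) : ℂ) * Complex.exp (-(r * u)) *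
      ((-(c * x * (u ^ ν : ℝ))) ^ n / (n.factorial : ℂ))) =
      c * (-(c * x)) ^ n / (n.factorial : ℂ) *
        (((u ^ (s - 1) : ℝ) : ℂ) * Complex.exp (-(r * u))) := by
    intro u (hu : 0 < u)
    have : u ^ (s - 1) = u ^ (ν - 1) * (u ^ ν) ^ n := by
      rw [← Real.rpow_natCast, ← Real.rpow_mul hu.le, ← Real.rpow_add hu]
      congr 1
      ring
    rw [this, neg_pow (c * x * _), neg_pow (c * x), mul_pow (c * x)]
    push_cast
    ring
  rw [setIntegral_congr_fun measurableSet_Ioi h1, integral_const_mul,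
    integral_rpow_mul_cexp_neg_mul hs0 hr0]
  have h2 : c ^ (n + 1) * r ^ (-s : ℂ) = Complex.exp ((π * s : ℝ) * Complex.I) := by
    rw [Complex.cpow_def_of_ne_zero (Complex.exp_ne_zero _), hlog, hc, ← Complex.exp_nat_mul,
      ← Complex.exp_add]
    congr 1
    rw [hs]
    push_cast
    ring
  have h3 : c * (-(c * x)) ^ n / (n.factorial : ℂ) * (Real.Gamma s * r ^ (-s : ℂ)) =
      (((-x) ^ n / (n.factorial : ℝ) * Real.Gamma s : ℝ) : ℂ) *
        Complex.exp ((π * s : ℝ) * Complex.I) := by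
    rw [← h2, neg_mul_eq_mul_neg, mul_pow]
    push_cast
    ring
  rw [h3, Complex.im_ofReal_mul, Complex.exp_ofReal_mul_I_im, mul_assoc, Gamma_mul_sin_pi_mul hs0,
    show 1 - ν - ν * n = 1 - s by rw [hs]; ring]
  ring

/-- The integral representation of the Mainardi function along a rotated ray. -/
lemma pi_mul_mainardi_eq_im_integral {ν φ : ℝ} (hν0 : 0 < ν) (hν1 : ν < 1) (hφ0 : π / 2 < φ)
    (hφ1 : φ ≤ π) (x : ℝ) :
    π * mainardi ν x =
    (∫ u in Ioi (0 : ℝ), Complex.exp (ν * φ * Complex.I) * (((u ^ (ν - 1) : ℝ) : ℂ) *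
      Complex.exp (-(Complex.exp ((φ - π) * Complex.I) * u)) *
      Complex.exp (-(Complex.exp (ν * φ * Complex.I) * x * (u ^ ν : ℝ))))).im := by
  have hterm := integral_mainardi_term hν0 hφ0 hφ1 x
  rw [mainardi, ← tsum_mul_left]
  simp_rw [← hterm]
  have hr0 : 0 < (Complex.exp ((φ - π) * Complex.I)).re := re_cexp_sub_pi_pos hφ0 hφ1
  generalize Complex.exp (ν * φ * Complex.I) = c at *
  generalize Complex.exp ((φ - π) * Complex.I) = r at *
  have hsum : ∀ u : ℝ, HasSum (fun n : ℕ => ‖c‖ * (u ^ (ν - 1) * Real.exp (-(r.re * u)) *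
      ((‖c‖ * |x| * u ^ ν) ^ n / n.factorial)))
      (‖c‖ * (u ^ (ν - 1) * Real.exp (-(r.re * u)) * Real.exp (‖c‖ * |x| * u ^ ν))) := by
    intro u
    refine HasSum.mul_left _ (HasSum.mul_left _ ?_)
    rw [Real.exp_eq_exp_ℝ]
    exact NormedSpace.expSeries_div_hasSum_exp _
  have hlim : ∀ u : ℝ, HasSum (fun n : ℕ => c * (((u ^ (ν - 1) : ℝ) : ℂ) *
      Complex.exp (-(r * u)) * ((-(c * x * (u ^ ν : ℝ))) ^ n / (n.factorial : ℂ))))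
      (c * (((u ^ (ν - 1) : ℝ) : ℂ) * Complex.exp (-(r * u)) *
        Complex.exp (-(c * x * (u ^ ν : ℝ))))) := by
    intro u
    refine HasSum.mul_left _ (HasSum.mul_left _ ?_)
    rw [Complex.exp_eq_exp_ℂ]
    exact NormedSpace.expSeries_div_hasSum_exp _
  refine (Complex.hasSum_im (hasSum_integral_of_dominated_convergence
    (μ := volume.restrict (Ioi 0))
    (fun (n : ℕ) (u : ℝ) => ‖c‖ * (u ^ (ν - 1) * Real.exp (-(r.re * u)) *
      ((‖c‖ * |x| * u ^ ν) ^ n / n.factorial)))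
    (fun n => Measurable.aestronglyMeasurable (by fun_prop)) (fun n => ?_)
    (.of_forall fun u => (hsum u).summable) ?_ (.of_forall hlim))).tsum_eq
  · filter_upwards [ae_restrict_mem measurableSet_Ioi] with u hu
    have hu : 0 < u := hu
    simp only [norm_mul, norm_div, norm_pow, norm_neg, norm_cexp_neg_mul_ofReal,
      Complex.norm_real, Complex.norm_natCast, Real.norm_eq_abs]
    rw [abs_of_pos (Real.rpow_pos_of_pos hu _), abs_of_pos (Real.rpow_pos_of_pos hu _)]
  · simp_rw [fun u => (hsum u).tsum_eq]
    exact (integrableOn_rpow_mul_exp_sub_linear hν0 hν1 (by positivity) hr0).const_mul _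

/-- Subtracting `1` from the exponential factor does not change the imaginary part. -/
lemma pi_mul_mul_mainardi {ν φ : ℝ} (hν0 : 0 < ν) (hν1 : ν < 1) (hφ0 : π / 2 < φ)
    (hφ1 : φ ≤ π) (hφν : ν * φ < π / 2) {x : ℝ} (hx : 0 < x) :
    π * (x * mainardi ν x) =
    (Complex.exp (ν * φ * Complex.I) * ∫ u in Ioi (0 : ℝ), (((u ^ (ν - 1) : ℝ) : ℂ) *
      (Complex.exp (-(Complex.exp ((φ - π) * Complex.I) * u)) - 1) *
      ((x : ℂ) * Complex.exp (-(Complex.exp (ν * φ * Complex.I) * (u ^ ν : ℝ) * x))))).im := by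
  have hM := pi_mul_mainardi_eq_im_integral hν0 hν1 hφ0 hφ1 x
  have hr0 : 0 < (Complex.exp ((φ - π) * Complex.I)).re := re_cexp_sub_pi_pos hφ0 hφ1
  have hc0 : 0 < (Complex.exp (ν * φ * Complex.I)).re := by
    rw [← Complex.ofReal_mul, Complex.exp_ofReal_mul_I_re]
    exact Real.cos_pos_of_mem_Ioo ⟨by nlinarith [Real.pi_pos], hφν⟩
  generalize Complex.exp (ν * φ * Complex.I) = c at *
  generalize Complex.exp ((φ - π) * Complex.I) = r at *
  have hw : 0 < (c * x).re := by rw [Complex.re_mul_ofReal]; positivity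
  have hc : c ≠ 0 := fun h => by simp [h] at hc0
  have hi2 := integrableOn_rpow_mul_cexp_neg_mul_rpow hν0 hw
  have hi1 : IntegrableOn (fun u : ℝ => ((u ^ (ν - 1) : ℝ) : ℂ) * Complex.exp (-(r * u)) *
      Complex.exp (-(c * x * (u ^ ν : ℝ)))) (Ioi 0) := by
    refine Integrable.mono' hi2.norm (by fun_prop) ?_
    filter_upwards [ae_restrict_mem measurableSet_Ioi] with u hu
    have hu : 0 < u := hu
    rw [norm_mul, norm_mul, norm_mul, norm_cexp_neg_mul_ofReal r]
    gcongr
    refine mul_le_of_le_one_right (norm_nonneg _) ?_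
    rw [Real.exp_le_one_iff]
    nlinarith [mul_pos hr0 hu]
  have hsplit : ∀ u : ℝ, ((u ^ (ν - 1) : ℝ) : ℂ) * (Complex.exp (-(r * u)) - 1) *
      ((x : ℂ) * Complex.exp (-(c * (u ^ ν : ℝ) * x))) =
      x * (((u ^ (ν - 1) : ℝ) : ℂ) * Complex.exp (-(r * u)) *
        Complex.exp (-(c * x * (u ^ ν : ℝ))) -
      ((u ^ (ν - 1) : ℝ) : ℂ) * Complex.exp (-(c * x * (u ^ ν : ℝ)))) := fun u => by
    rw [mul_right_comm c]
    ring
  simp_rw [hsplit]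
  rw [integral_const_mul, integral_sub hi1 hi2, integral_rpow_mul_cexp_neg_mul_rpow hν0 hw]
  rw [integral_const_mul] at hM
  have hreal : c * (x * (ν * (c * x))⁻¹) = ((ν⁻¹ : ℝ) : ℂ) := by
    have hxc : (x : ℂ) ≠ 0 := by exact_mod_cast hx.ne'
    push_cast
    field_simp
  rw [mul_sub, mul_sub, Complex.sub_im, hreal, Complex.ofReal_im, sub_zero, mul_left_comm c,
    Complex.im_ofReal_mul, ← hM, mul_left_comm]

lemma exists_angle {ν : ℝ} (hν0 : 0 < ν) (hν1 : ν < 1) :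
    ∃ φ, π / 2 < φ ∧ φ ≤ π ∧ ν * φ < π / 2 := by
  have hπ := Real.pi_pos
  obtain ⟨φ, h1, h2⟩ := exists_between (show π / 2 < min π (π / 2 / ν) from
    lt_min (by linarith) (by rw [lt_div_iff₀ hν0]; nlinarith))
  rw [lt_min_iff, lt_div_iff₀ hν0] at h2
  exact ⟨φ, h1, h2.1.le, by linarith⟩

/-- The first moment of the Mainardi function. -/
lemma integral_mul_mainardi {ν : ℝ} (hν0 : 0 < ν) (hν1 : ν < 1) :
    IntegrableOn (fun x : ℝ => x * mainardi ν x) (Ioi 0) ∧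
    ∫ x in Ioi (0 : ℝ), x * mainardi ν x = (Real.Gamma (1 + ν))⁻¹ := by
  obtain ⟨φ, hφ0, hφ1, hφν⟩ := exists_angle hν0 hν1
  set c := Complex.exp (ν * φ * Complex.I) with hc
  set r := Complex.exp ((φ - π) * Complex.I) with hr
  have hr0 : 0 < r.re := re_cexp_sub_pi_pos hφ0 hφ1
  have hc0 : 0 < c.re := by
    rw [hc, ← Complex.ofReal_mul, Complex.exp_ofReal_mul_I_re]
    exact Real.cos_pos_of_mem_Ioo ⟨by nlinarith [Real.pi_pos], hφν⟩
  have hlog : Complex.log r = (φ - π) * Complex.I := log_cexp_sub_pi hφ0 hφ1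
  have hK := integrable_mul_kernel hν0 hν1 hr0 hc0
  have hKx := hK.integral_prod_left.const_mul c
  simp only [Function.uncurry] at hKx
  have heq : ∀ x ∈ Ioi (0 : ℝ), x * mainardi ν x = π⁻¹ *
      (c * ∫ u in Ioi (0 : ℝ), (((u ^ (ν - 1) : ℝ) : ℂ) * (Complex.exp (-(r * u)) - 1) *
        ((x : ℂ) * Complex.exp (-(c * (u ^ ν : ℝ) * x))))).im := fun x hx => by
    rw [← pi_mul_mul_mainardi hν0 hν1 hφ0 hφ1 hφν hx, inv_mul_cancel_left₀ Real.pi_ne_zero]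
  constructor
  · exact IntegrableOn.congr_fun (hKx.im.const_mul π⁻¹) (fun x hx => (heq x hx).symm)
      measurableSet_Ioi
  have hinner : ∀ u ∈ Ioi (0 : ℝ), ∫ x in Ioi (0 : ℝ), (((u ^ (ν - 1) : ℝ) : ℂ) *
      (Complex.exp (-(r * u)) - 1) * ((x : ℂ) * Complex.exp (-(c * (u ^ ν : ℝ) * x)))) =
      (c ^ 2)⁻¹ * (((u ^ (-ν - 1) : ℝ) : ℂ) * (Complex.exp (-(r * u)) - 1)) := by
    intro u (hu : 0 < u)
    rw [integral_const_mul, integral_mul_cexp_neg_mul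
      (by rw [Complex.re_mul_ofReal]; positivity)]
    have h : u ^ (-ν - 1) = u ^ (ν - 1) * ((u ^ ν) ^ 2)⁻¹ := by
      rw [Real.rpow_sub_one hu.ne', Real.rpow_sub_one hu.ne', Real.rpow_neg hu.le]
      field_simp
    rw [h, mul_pow, mul_inv]
    push_cast
    ring
  have him := integral_im hKx
  simp only [RCLike.im_to_complex] at him
  rw [setIntegral_congr_fun measurableSet_Ioi heq, integral_const_mul, him, integral_const_mul,
    integral_integral_swap hK, setIntegral_congr_fun measurableSet_Ioi hinner,
    integral_const_mul, integral_rpow_mul_cexp_sub_one hν0 hν1 hr0]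
  have hval : c * ((c ^ 2)⁻¹ * (Real.Gamma (-ν) * r ^ (ν : ℂ))) =
      (Real.Gamma (-ν) : ℂ) * Complex.exp ((-(π * ν) : ℝ) * Complex.I) := by
    have h : Complex.exp ((-(π * ν) : ℝ) * Complex.I) = c⁻¹ * r ^ (ν : ℂ) := by
      rw [Complex.cpow_def_of_ne_zero (Complex.exp_ne_zero _), hlog, hc, ← Complex.exp_neg,
        ← Complex.exp_add]
      congr 1
      push_cast
      ring
    have hc' : c ≠ 0 := Complex.exp_ne_zero _
    rw [h]
    field_simp
  rw [hval, Complex.im_ofReal_mul, Complex.exp_ofReal_mul_I_im, Real.sin_neg]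
  have hG1 := Real.Gamma_mul_Gamma_one_sub (-ν)
  have hsin : 0 < Real.sin (π * ν) :=
    Real.sin_pos_of_pos_of_lt_pi (by positivity) (by nlinarith [Real.pi_pos])
  rw [sub_neg_eq_add, mul_neg, Real.sin_neg, div_neg] at hG1
  have hΓ : 0 < Real.Gamma (1 + ν) := Real.Gamma_pos_of_pos (by linarith)
  have hmul : Real.Gamma (-ν) * Real.Gamma (1 + ν) * Real.sin (π * ν) = -π := by
    rw [hG1, neg_mul, div_mul_cancel₀ _ hsin.ne']
  refine eq_inv_of_mul_eq_one_left ?_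
  have hπ := inv_mul_cancel₀ Real.pi_ne_zero
  linear_combination hπ - π⁻¹ * hmul

theorem greenSignaling_space_integral (ν : ℝ) (hν0 : 0 < ν) (hν1 : ν < 1)
    (t : ℝ) (ht : 0 < t) :
    IntegrableOn (fun r : ℝ => greenSignaling ν r t) (Ioi 0) ∧
    ∫ r in Ioi (0 : ℝ), greenSignaling ν r t = ν * t ^ (ν - 1) / Real.Gamma (1 + ν) := by
  obtain ⟨hi, hv⟩ := integral_mul_mainardi hν0 hν1
  have htν : 0 < (t ^ ν)⁻¹ := by positivity
  have hG : (fun r : ℝ => greenSignaling ν r t) = fun r : ℝ =>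
      ν / t * (((t ^ ν)⁻¹ * r) * mainardi ν ((t ^ ν)⁻¹ * r)) := by
    funext r
    rw [greenSignaling, Real.rpow_add_one ht.ne', div_eq_inv_mul r]
    field_simp
  rw [hG]
  constructor
  · refine Integrable.const_mul ?_ _
    have h := (integrableOn_Ioi_comp_mul_left_iff (fun x : ℝ => x * mainardi ν x) 0 htν).mpr
      (by rwa [mul_zero])
    exact h
  · rw [integral_const_mul, integral_comp_mul_left_Ioi (fun x : ℝ => x * mainardi ν x) 0 htν,
      mul_zero, hv, inv_inv, smul_eq_mul, Real.rpow_sub_one ht.ne']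
    ring
end
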